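/- arXiv:2104.05669 — 2 statements merged into one kernel-verified Lean document; each statement's English description precedes it below -/
import Mathlib

section
/- Let Σ be a symmetric positive definite real k×k matrix, Ψ a symmetric positive definite real n×n matrix, and M a real k×n matrix. Let W be an exponential random variable with rate 1 and let X be a random real k×n matrix, independent of W, such that vec(X) is a centered multivariate Gaussian vector with covariance matrix Ψ ⊗ Σ. Set Y = W·M + √W·X. Then for every real k×n matrix T, E[exp(i·tr(Tᵀ Y))] = 1 / (1 + ½·tr(Ψ Tᵀ Σ T) − i·tr(Mᵀ T)). -/
open MeasureTheory ProbabilityTheory Matrix Complex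
open scoped Kronecker

/-- The (pi-type) measurable space structure on real matrices. -/
instance matrixMeasurableSpace {m n : Type*} : MeasurableSpace (Matrix m n ℝ) :=
  MeasurableSpace.pi

/-- The vectorization of a real `k × n` matrix: the vector indexed by pairs
`(j, i) ∈ Fin n × Fin k` with entry `vecM A (j, i) = A i j` (columns stacked). -/
def vecM {k n : ℕ} (A : Matrix (Fin k) (Fin n) ℝ) : Fin n × Fin k → ℝ :=
  fun p => A p.2 p.1

/-- The measure `μ` on `ι → ℝ` is the centered multivariate Gaussian measure with
covariance matrix `S`, characterized by its characteristic function
`t ↦ exp(−½ tᵀ S t)`. -/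
def IsCenteredGaussianLaw {ι : Type*} [Fintype ι] (μ : Measure (ι → ℝ))
    (S : Matrix ι ι ℝ) : Prop :=
  IsProbabilityMeasure μ ∧
    ∀ t : ι → ℝ, ∫ x, Complex.exp (Complex.I * ((t ⬝ᵥ x : ℝ) : ℂ)) ∂μ =
      Complex.exp (-(1 / 2 : ℂ) * ((t ⬝ᵥ S.mulVec t : ℝ) : ℂ))

theorem integral_expMeasure {E : Type*} [NormedAddCommGroup E] [NormedSpace ℝ E] {r : ℝ}
    (hr : 0 < r) (g : ℝ → E) :
    ∫ x, g x ∂expMeasure r = ∫ x in Set.Ioi 0, (r * Real.exp (-(r * x))) • g x := by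
  have hmeas : Measurable (exponentialPDF r) :=
    (measurable_exponentialPDFReal r).ennreal_ofReal
  have hexp : expMeasure r = volume.withDensity (exponentialPDF r) := rfl
  rw [hexp, integral_withDensity_eq_integral_toReal_smul hmeas
      (Filter.Eventually.of_forall fun _ => ENNReal.ofReal_lt_top),
    ← integral_Ici_eq_integral_Ioi, ← integral_indicator measurableSet_Ici]
  congr 1 with x
  by_cases hx : 0 ≤ x
  · rw [Set.indicator_of_mem (Set.mem_Ici.2 hx), exponentialPDF_of_nonneg hx,
      ENNReal.toReal_ofReal (by positivity)]
  · rw [Set.indicator_of_notMem (by simpa using hx), exponentialPDF_of_neg (not_le.1 hx)]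
    simp

theorem ae_expMeasure_pos (r : ℝ) : ∀ᵐ x ∂expMeasure r, 0 < x := by
  have hmeas : Measurable (exponentialPDF r) :=
    (measurable_exponentialPDFReal r).ennreal_ofReal
  have hexp : expMeasure r = volume.withDensity (exponentialPDF r) := rfl
  rw [hexp, ae_withDensity_iff hmeas]
  filter_upwards [Measure.ae_ne volume (0 : ℝ)] with x hx0 hx
  by_contra h
  exact hx (exponentialPDF_of_neg (lt_of_le_of_ne (not_lt.1 h) hx0))

/-- The Laplace transform of the exponential law with rate `r`. -/
theorem integral_cexp_mul_expMeasure {r : ℝ} (hr : 0 < r) {c : ℂ} (hc : c.re < r) :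
    ∫ x : ℝ, Complex.exp (c * x) ∂expMeasure r = r / (r - c) := by
  have hre : (c - r).re < 0 := by simpa using hc
  have hne : c - r ≠ 0 := fun h => by simp [h] at hre
  have hne' : (r : ℂ) - c ≠ 0 := fun h => hne (by linear_combination -h)
  have hint : ∀ x : ℝ, (r * Real.exp (-(r * x))) • Complex.exp (c * x) =
      r * Complex.exp ((c - r) * x) := by
    intro x
    rw [Complex.real_smul]
    push_cast
    rw [mul_assoc, ← Complex.exp_add]
    ring_nf
  simp_rw [integral_expMeasure hr, hint]
  rw [integral_const_mul, integral_exp_mul_complex_Ioi hre]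
  simp only [Complex.ofReal_zero, mul_zero, Complex.exp_zero]
  field_simp
  ring

theorem vecM_dotProduct_vecM {k n : ℕ} (A B : Matrix (Fin k) (Fin n) ℝ) :
    vecM A ⬝ᵥ vecM B = (Aᵀ * B).trace :=
  vec_dotProduct_vec A B

theorem vecM_dotProduct_kronecker_mulVec {k n : ℕ} (S : Matrix (Fin k) (Fin k) ℝ)
    {Ψ : Matrix (Fin n) (Fin n) ℝ} (hΨ : Ψ.IsSymm) (T : Matrix (Fin k) (Fin n) ℝ) :
    vecM T ⬝ᵥ (Ψ ⊗ₖ S) *ᵥ vecM T = (Ψ * Tᵀ * S * T).trace := by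
  change vec T ⬝ᵥ (Ψ ⊗ₖ S) *ᵥ vec T = _
  rw [kronecker_mulVec_vec, vec_dotProduct_vec, hΨ.eq, ← Matrix.mul_assoc, trace_mul_comm]
  simp only [Matrix.mul_assoc]

theorem measurable_vecM {k n : ℕ} :
    Measurable (vecM : Matrix (Fin k) (Fin n) ℝ → Fin n × Fin k → ℝ) :=
  measurable_pi_lambda _ fun p => (measurable_pi_apply p.1).comp (measurable_pi_apply p.2)

/-- The characteristic function of the variance-mean mixture `w a + √w v`, for `w ≥ 0` fixed. -/
theorem IsCenteredGaussianLaw.integral_cexp_add_sqrt_mul {ι : Type*} [Fintype ι]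
    {μ : Measure (ι → ℝ)} {S : Matrix ι ι ℝ} (hμ : IsCenteredGaussianLaw μ S) (t : ι → ℝ)
    (a : ℝ) {w : ℝ} (hw : 0 ≤ w) :
    ∫ v, Complex.exp (Complex.I * ((w * a + √w * (t ⬝ᵥ v) : ℝ) : ℂ)) ∂μ =
      Complex.exp ((Complex.I * a - (1 / 2 : ℂ) * ((t ⬝ᵥ S *ᵥ t : ℝ) : ℂ)) * w) := by
  have h := hμ.2 (√w • t)
  have hq : √w • t ⬝ᵥ S *ᵥ (√w • t) = w * (t ⬝ᵥ S *ᵥ t) := by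
    rw [mulVec_smul, smul_dotProduct, dotProduct_smul, smul_eq_mul, smul_eq_mul, ← mul_assoc,
      Real.mul_self_sqrt hw]
  have hsplit : ∀ v : ι → ℝ, Complex.exp (Complex.I * ((w * a + √w * (t ⬝ᵥ v) : ℝ) : ℂ)) =
      Complex.exp (Complex.I * a * w) * Complex.exp (Complex.I * ((√w • t ⬝ᵥ v : ℝ) : ℂ)) := by
    intro v
    rw [← Complex.exp_add, smul_dotProduct, smul_eq_mul]
    push_cast
    ring_nf
  simp_rw [hsplit]
  rw [integral_const_mul, h, hq, ← Complex.exp_add]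
  push_cast
  ring_nf

/-- If `W ∼ Exp(1)` and `X` is a random `k × n` matrix, independent of `W`, with
`vec(X)` centered Gaussian with covariance `Ψ ⊗ Σ`, then `Y = W M + √W X` has
characteristic function `T ↦ 1 / (1 + ½ tr(Ψ Tᵀ Σ T) − i tr(Mᵀ T))`. -/
theorem charFun_matrix_asymmetric_laplace {Ω : Type*} [MeasurableSpace Ω]
    (P : Measure Ω) [IsProbabilityMeasure P] {k n : ℕ}
    (S : Matrix (Fin k) (Fin k) ℝ) (Ψ : Matrix (Fin n) (Fin n) ℝ)
    (hS : S.PosDef) (hSs : S.IsSymm) (hΨ : Ψ.PosDef) (hΨs : Ψ.IsSymm)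
    (M : Matrix (Fin k) (Fin n) ℝ)
    (W : Ω → ℝ) (X : Ω → Matrix (Fin k) (Fin n) ℝ)
    (hWm : Measurable W) (hXm : Measurable X)
    (hW : P.map W = expMeasure 1)
    (hX : IsCenteredGaussianLaw (P.map fun ω => vecM (X ω)) (Ψ ⊗ₖ S))
    (hindep : IndepFun W X P)
    (Y : Ω → Matrix (Fin k) (Fin n) ℝ)
    (hY : Y = fun ω => W ω • M + Real.sqrt (W ω) • X ω) :
    ∀ T : Matrix (Fin k) (Fin n) ℝ,
      ∫ ω, Complex.exp (Complex.I * ((Matrix.trace (Tᵀ * Y ω) : ℝ) : ℂ)) ∂P =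
        1 / (1 + (1 / 2 : ℂ) * ((Matrix.trace (Ψ * Tᵀ * S * T) : ℝ) : ℂ)
          - Complex.I * ((Matrix.trace (Mᵀ * T) : ℝ) : ℂ)) := by
  intro T
  have : IsProbabilityMeasure (P.map fun ω => vecM (X ω)) := hX.1
  have : IsProbabilityMeasure (expMeasure 1) := isProbabilityMeasure_expMeasure one_pos
  set q : ℝ := (Ψ * Tᵀ * S * T).trace with hq
  set a : ℝ := (Mᵀ * T).trace with ha
  have hq0 : 0 ≤ q := by
    rw [hq, ← vecM_dotProduct_kronecker_mulVec S hΨs T]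
    simpa using (hΨ.posSemidef.kronecker hS.posSemidef).dotProduct_mulVec_nonneg (vecM T)
  have hVm : Measurable fun ω => vecM (X ω) := measurable_vecM.comp hXm
  have hjoint : P.map (fun ω => (W ω, vecM (X ω))) =
      (expMeasure 1).prod (P.map fun ω => vecM (X ω)) := by
    rw [← hW]
    exact (hindep.comp measurable_id measurable_vecM).map_prod_eq_prod_map_map
      hWm.aemeasurable hVm.aemeasurable
  set F : ℝ × (Fin n × Fin k → ℝ) → ℂ := fun p =>
    Complex.exp (Complex.I * ((p.1 * a + √p.1 * (vecM T ⬝ᵥ p.2) : ℝ) : ℂ)) with hF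
  have hFm : Measurable F := by
    simp only [hF, dotProduct]
    fun_prop
  have hFint : Integrable F ((expMeasure 1).prod (P.map fun ω => vecM (X ω))) :=
    Integrable.of_bound hFm.aestronglyMeasurable 1
      (Filter.Eventually.of_forall fun _ => (Complex.norm_exp_I_mul_ofReal _).le)
  have hYF : ∀ ω, Complex.exp (Complex.I * (((Tᵀ * Y ω).trace : ℝ) : ℂ)) =
      F (W ω, vecM (X ω)) := by
    intro ω
    have htr : (Tᵀ * M).trace = a := by
      rw [ha, ← trace_transpose, transpose_mul, transpose_transpose]
    simp only [hF, hY, vecM_dotProduct_vecM, Matrix.mul_add, Matrix.mul_smul, trace_add,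
      trace_smul, smul_eq_mul, htr]
  calc ∫ ω, Complex.exp (Complex.I * (((Tᵀ * Y ω).trace : ℝ) : ℂ)) ∂P
      = ∫ p, F p ∂(P.map fun ω => (W ω, vecM (X ω))) := by
        simp_rw [hYF]
        exact (integral_map (hWm.prodMk hVm).aemeasurable hFm.aestronglyMeasurable).symm
    _ = ∫ w, ∫ v, F (w, v) ∂(P.map fun ω => vecM (X ω)) ∂expMeasure 1 := by
        rw [hjoint, integral_prod F hFint]
    _ = ∫ w : ℝ, Complex.exp ((Complex.I * a - (1 / 2 : ℂ) * q) * w) ∂expMeasure 1 := by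
        refine integral_congr_ae ?_
        filter_upwards [ae_expMeasure_pos 1] with w hw
        rw [hX.integral_cexp_add_sqrt_mul (vecM T) a hw.le,
          vecM_dotProduct_kronecker_mulVec S hΨs T]
    _ = 1 / (1 + (1 / 2 : ℂ) * q - Complex.I * a) := by
        rw [integral_cexp_mul_expMeasure one_pos]
        · push_cast
          ring_nf
        · have hre : (Complex.I * a - (1 / 2 : ℂ) * q).re = -(1 / 2 * q) := by
            simp
          linarith
end

section
/- Let λ > 0, let Σ₁, …, Σ_D be symmetric positive definite real matrices, where Σᵢ has size nᵢ×nᵢ, set n* = n₁⋯n_D and let S = Σ₁ ⊗ Σ₂ ⊗ ⋯ ⊗ Σ_D be their iterated Kronecker product. Let μ ∈ ℝ^{n*}, let W have the standard Gamma distribution with shape parameter λ and let Z be a centered multivariate Gaussian random vector in ℝ^{n*} with covariance matrix S, with W and Z independent. Set Y = W·μ + √W·Z. Then for all coordinates j, l: E[Y_j·Y_l] − E[Y_j]·E[Y_l] = λ·(S_{j,l} + μ_j·μ_l); that is, the variance-covariance matrix of Y equals λ·(Σ₁ ⊗ ⋯ ⊗ Σ_D + μ·μᵀ). -/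
open MeasureTheory ProbabilityTheory Matrix Complex

/-- The iterated Kronecker product `Σ₁ ⊗ Σ₂ ⊗ ⋯ ⊗ Σ_D` of square matrices
`Σᵢ : Matrix (Fin (n i)) (Fin (n i)) ℝ`, indexed (after the canonical reindexing
of index tuples) by the type `∀ i, Fin (n i)`: its `(x, y)` entry is
`∏ i, Σᵢ (x i) (y i)`. -/
def bigKron {D : ℕ} (n : Fin D → ℕ)
    (S : ∀ i, Matrix (Fin (n i)) (Fin (n i)) ℝ) :
    Matrix (∀ i, Fin (n i)) (∀ i, Fin (n i)) ℝ :=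
  Matrix.of fun x y => ∏ i, S i (x i) (y i)

lemma bigKron_isSymm {D : ℕ} (n : Fin D → ℕ) {S : ∀ i, Matrix (Fin (n i)) (Fin (n i)) ℝ}
    (hS : ∀ i, (S i).IsSymm) : (bigKron n S).IsSymm :=
  Matrix.IsSymm.ext fun x y => by
    simp only [bigKron, of_apply, fun i => (hS i).apply (x i) (y i)]

section GammaMoments

lemma gammaPDF_toReal_mul_rpow {a : ℝ} (ha : 0 < a) (s : ℝ) {x : ℝ} (hx : 0 < x) :
    (gammaPDF a 1 x).toReal • x ^ s =
      (Real.Gamma a)⁻¹ * (Real.exp (-x) * x ^ (a + s - 1)) := by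
  rw [gammaPDF, ENNReal.toReal_ofReal (gammaPDFReal_nonneg ha one_pos x), gammaPDFReal,
    if_pos hx.le, add_sub_right_comm, Real.rpow_add hx, Real.one_rpow, one_mul, smul_eq_mul]
  ring

lemma gammaPDF_toReal_smul_ae_eq_indicator {a : ℝ} (f : ℝ → ℝ) :
    (fun x => (gammaPDF a 1 x).toReal • f x) =ᵐ[volume]
      (Set.Ioi 0).indicator fun x => (gammaPDF a 1 x).toReal • f x := by
  filter_upwards [Measure.ae_ne volume (0 : ℝ)] with x hx
  rcases lt_or_gt_of_ne hx with h | h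
  · rw [Set.indicator_of_notMem (by simpa using h.le), gammaPDF_of_neg h]
    simp
  · rw [Set.indicator_of_mem (by simpa using h)]

lemma measurable_gammaPDF (a r : ℝ) : Measurable (gammaPDF a r) :=
  (measurable_gammaPDFReal a r).ennreal_ofReal

lemma integrable_rpow_gammaMeasure {a s : ℝ} (ha : 0 < a) (has : 0 < a + s) :
    Integrable (fun x : ℝ => x ^ s) (gammaMeasure a 1) := by
  rw [gammaMeasure, integrable_withDensity_iff_integrable_smul' (measurable_gammaPDF a 1)
    (ae_of_all _ fun _ => ENNReal.ofReal_lt_top),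
    integrable_congr (gammaPDF_toReal_smul_ae_eq_indicator _),
    integrable_indicator_iff measurableSet_Ioi]
  exact IntegrableOn.congr_fun ((Real.GammaIntegral_convergent has).const_mul _)
    (fun x hx => (gammaPDF_toReal_mul_rpow ha s hx).symm) measurableSet_Ioi

lemma integral_rpow_gammaMeasure {a s : ℝ} (ha : 0 < a) (has : 0 < a + s) :
    ∫ x, x ^ s ∂gammaMeasure a 1 = Real.Gamma (a + s) / Real.Gamma a := by
  rw [gammaMeasure, integral_withDensity_eq_integral_toReal_smul (measurable_gammaPDF a 1)
    (ae_of_all _ fun _ => ENNReal.ofReal_lt_top),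
    integral_congr_ae (gammaPDF_toReal_smul_ae_eq_indicator _),
    integral_indicator measurableSet_Ioi,
    setIntegral_congr_fun measurableSet_Ioi fun x hx => gammaPDF_toReal_mul_rpow ha s hx,
    integral_const_mul, ← Real.Gamma_eq_integral has, div_eq_inv_mul]

lemma integral_id_gammaMeasure {a : ℝ} (ha : 0 < a) : ∫ x, x ∂gammaMeasure a 1 = a := by
  have h := integral_rpow_gammaMeasure ha (add_pos ha one_pos)
  simpa [Real.Gamma_add_one ha.ne', (Real.Gamma_pos_of_pos ha).ne'] using h

lemma integral_sq_gammaMeasure {a : ℝ} (ha : 0 < a) :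
    ∫ x, x ^ 2 ∂gammaMeasure a 1 = a * (a + 1) := by
  have h := integral_rpow_gammaMeasure ha (add_pos ha two_pos)
  rw [show a + 2 = a + 1 + 1 by ring, Real.Gamma_add_one (by positivity),
    Real.Gamma_add_one ha.ne'] at h
  simp only [Real.rpow_two] at h
  rw [h]
  field_simp [(Real.Gamma_pos_of_pos ha).ne']

lemma ae_nonneg_gammaMeasure (a r : ℝ) : ∀ᵐ x ∂gammaMeasure a r, 0 ≤ x := by
  rw [gammaMeasure, ae_withDensity_iff (measurable_gammaPDF a r)]
  exact ae_of_all _ fun x hx => not_lt.mp fun h => hx (gammaPDF_of_neg h)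

end GammaMoments

namespace IsCenteredGaussianLaw

variable {ι : Type*} [Fintype ι] {μ : Measure (ι → ℝ)} {S : Matrix ι ι ℝ}

lemma quadForm_nonneg (h : IsCenteredGaussianLaw μ S) (t : ι → ℝ) : 0 ≤ t ⬝ᵥ S.mulVec t := by
  have := h.1
  have hle : ‖∫ x, Complex.exp (Complex.I * ((t ⬝ᵥ x : ℝ) : ℂ)) ∂μ‖ ≤ 1 := by
    refine (norm_integral_le_of_norm_le_const (C := 1) (ae_of_all _ fun x => ?_)).trans (by simp)
    rw [mul_comm, Complex.norm_exp_ofReal_mul_I]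
  rw [h.2 t, Complex.norm_exp, Real.exp_le_one_iff] at hle
  norm_num [Complex.mul_re] at hle
  exact hle

lemma map_dotProduct (h : IsCenteredGaussianLaw μ S) (t : ι → ℝ) :
    μ.map (fun x => t ⬝ᵥ x) = gaussianReal 0 (t ⬝ᵥ S.mulVec t).toNNReal := by
  have := h.1
  have hm : Measurable fun x : ι → ℝ => t ⬝ᵥ x := by unfold dotProduct; fun_prop
  have := Measure.isProbabilityMeasure_map (μ := μ) hm.aemeasurable
  refine Measure.ext_of_charFun (funext fun r => ?_)
  rw [charFun_apply_real, charFun_gaussianReal, integral_map hm.aemeasurable (by fun_prop)]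
  convert! h.2 (r • t) using 2
  · funext x
    rw [smul_dotProduct, smul_eq_mul]
    push_cast
    ring_nf
  · rw [Real.coe_toNNReal _ (h.quadForm_nonneg t), mulVec_smul, smul_dotProduct,
      dotProduct_smul, smul_eq_mul, smul_eq_mul]
    push_cast
    ring

lemma memLp_dotProduct (h : IsCenteredGaussianLaw μ S) (t : ι → ℝ) :
    MemLp (fun x => t ⬝ᵥ x) 2 μ := by
  have hm : Measurable fun x : ι → ℝ => t ⬝ᵥ x := by unfold dotProduct; fun_prop
  have hid := memLp_id_gaussianReal (μ := 0) (v := (t ⬝ᵥ S.mulVec t).toNNReal) 2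
  rw [← h.map_dotProduct t] at hid
  exact (memLp_map_measure_iff (by fun_prop) hm.aemeasurable).mp hid

lemma integral_dotProduct (h : IsCenteredGaussianLaw μ S) (t : ι → ℝ) :
    ∫ x, t ⬝ᵥ x ∂μ = 0 := by
  have hm : Measurable fun x : ι → ℝ => t ⬝ᵥ x := by unfold dotProduct; fun_prop
  have hid := integral_id_gaussianReal (μ := 0) (v := (t ⬝ᵥ S.mulVec t).toNNReal)
  rwa [← h.map_dotProduct t, integral_map hm.aemeasurable (by fun_prop)] at hid

lemma integral_dotProduct_sq (h : IsCenteredGaussianLaw μ S) (t : ι → ℝ) :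
    ∫ x, (t ⬝ᵥ x) ^ 2 ∂μ = t ⬝ᵥ S.mulVec t := by
  have hm : Measurable fun x : ι → ℝ => t ⬝ᵥ x := by unfold dotProduct; fun_prop
  have hv := variance_id_gaussianReal (μ := 0) (v := (t ⬝ᵥ S.mulVec t).toNNReal)
  rw [variance_of_integral_eq_zero (by fun_prop) (by simp), ← h.map_dotProduct t,
    integral_map hm.aemeasurable (by fun_prop), Real.coe_toNNReal _ (h.quadForm_nonneg t)] at hv
  exact hv

lemma memLp_eval (h : IsCenteredGaussianLaw μ S) (j : ι) : MemLp (fun x => x j) 2 μ := by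
  classical
  simpa using h.memLp_dotProduct (Pi.single j 1)

lemma integral_eval (h : IsCenteredGaussianLaw μ S) (j : ι) : ∫ x, x j ∂μ = 0 := by
  classical
  simpa using h.integral_dotProduct (Pi.single j 1)

lemma integral_eval_mul_eval (h : IsCenteredGaussianLaw μ S) (hS : S.IsSymm) (j l : ι) :
    ∫ x, x j * x l ∂μ = S j l := by
  classical
  have hadd := h.integral_dotProduct_sq (Pi.single j 1 + Pi.single l 1)
  have hsub := h.integral_dotProduct_sq (Pi.single j 1 - Pi.single l 1)
  have hpol : ∀ x : ι → ℝ, x j * x l = (1 / 4) * (((Pi.single j 1 + Pi.single l 1) ⬝ᵥ x) ^ 2 -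
      ((Pi.single j 1 - Pi.single l 1) ⬝ᵥ x) ^ 2) := fun x => by
    simp only [add_dotProduct, sub_dotProduct, single_one_dotProduct]
    ring
  simp_rw [hpol]
  rw [integral_const_mul, integral_sub (h.memLp_dotProduct _).integrable_sq
    (h.memLp_dotProduct _).integrable_sq, hadd, hsub]
  simp only [add_dotProduct, sub_dotProduct, mulVec_add, mulVec_sub, mulVec_single_one,
    single_one_dotProduct, Pi.add_apply, Pi.sub_apply, col_apply]
  rw [hS.apply j l]
  ring

end IsCenteredGaussianLaw

/-- Tensor variate generalized asymmetric Laplace: if `W ∼ Gamma(λ, 1)` and `Z` is a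
centered Gaussian vector with covariance `Σ₁ ⊗ ⋯ ⊗ Σ_D`, independent of `W`, then the
variance-covariance matrix of `Y = W μ + √W Z` equals `λ (Σ₁ ⊗ ⋯ ⊗ Σ_D + μ μᵀ)`. -/
theorem covariance_tensor_generalized_asymmetric_laplace {Ω : Type*} [MeasurableSpace Ω]
    (P : Measure Ω) [IsProbabilityMeasure P] {D : ℕ} {lam : ℝ} (hlam : 0 < lam) (n : Fin D → ℕ)
    (S : ∀ i, Matrix (Fin (n i)) (Fin (n i)) ℝ)
    (hS : ∀ i, (S i).PosDef ∧ (S i).IsSymm)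
    (mu : (∀ i, Fin (n i)) → ℝ)
    (W : Ω → ℝ) (Z : Ω → (∀ i, Fin (n i)) → ℝ)
    (hWm : Measurable W) (hZm : Measurable Z)
    (hW : P.map W = gammaMeasure lam 1)
    (hZ : IsCenteredGaussianLaw (P.map Z) (bigKron n S))
    (hindep : IndepFun W Z P)
    (Y : Ω → (∀ i, Fin (n i)) → ℝ)
    (hY : Y = fun ω => W ω • mu + Real.sqrt (W ω) • Z ω) :
    ∀ j l : ∀ i, Fin (n i),
      (∫ ω, Y ω j * Y ω l ∂P) - (∫ ω, Y ω j ∂P) * (∫ ω, Y ω l ∂P) =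
        lam * (bigKron n S j l + mu j * mu l) := by
  intro j l
  subst hY
  have hsymm := bigKron_isSymm n fun i => (hS i).2
  have hWnonneg : ∀ᵐ ω ∂P, 0 ≤ W ω :=
    ae_of_ae_map hWm.aemeasurable (hW ▸ ae_nonneg_gammaMeasure lam 1)
  have hWrpow : ∀ s : ℝ, 0 ≤ s → Integrable (fun ω => W ω ^ s) P := fun s hs => by
    have h := integrable_rpow_gammaMeasure hlam (add_pos_of_pos_of_nonneg hlam hs)
    rw [← hW] at h
    exact h.comp_measurable hWm
  have hWint : Integrable W P := by simpa using hWrpow 1 one_pos.le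
  have hWsq : Integrable (fun ω => W ω ^ 2) P := by simpa using hWrpow 2 two_pos.le
  have hWsqrt : Integrable (fun ω => √(W ω)) P := by
    simpa [Real.sqrt_eq_rpow] using hWrpow (1 / 2) (by norm_num)
  have hWsqrt' : Integrable (fun ω => W ω * √(W ω)) P := by
    refine (hWrpow (1 + 1 / 2) (by norm_num)).congr ?_
    filter_upwards [hWnonneg] with ω hω
    rw [Real.rpow_add_of_nonneg hω (by norm_num) (by norm_num), Real.rpow_one,
      Real.sqrt_eq_rpow]
  have hEW : ∫ ω, W ω ∂P = lam := by
    rw [← integral_id_gammaMeasure hlam, ← hW, integral_map hWm.aemeasurable (by fun_prop)]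
  have hEWsq : ∫ ω, W ω ^ 2 ∂P = lam * (lam + 1) := by
    rw [← integral_sq_gammaMeasure hlam, ← hW, integral_map hWm.aemeasurable (by fun_prop)]
  have hZmem : ∀ k, MemLp (fun ω => Z ω k) 2 P := fun k =>
    (hZ.memLp_eval k).comp_measurePreserving ⟨hZm, rfl⟩
  have hZint : ∀ k, Integrable (fun ω => Z ω k) P := fun k => (hZmem k).integrable one_le_two
  have hEZ : ∀ k, ∫ ω, Z ω k ∂P = 0 := fun k => by
    rw [← hZ.integral_eval k,
      integral_map hZm.aemeasurable (measurable_pi_apply k).aestronglyMeasurable]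
  have hEZZ : ∫ ω, Z ω j * Z ω l ∂P = bigKron n S j l := by
    rw [← hZ.integral_eval_mul_eval hsymm, integral_map hZm.aemeasurable (by fun_prop)]
  have hmul : ∀ {f : ℝ → ℝ} {g : ((∀ i, Fin (n i)) → ℝ) → ℝ}, Measurable f → Measurable g →
      Integrable (fun ω => f (W ω)) P → Integrable (fun ω => g (Z ω)) P →
      Integrable (fun ω => f (W ω) * g (Z ω)) P ∧
        ∫ ω, f (W ω) * g (Z ω) ∂P = (∫ ω, f (W ω) ∂P) * ∫ ω, g (Z ω) ∂P :=
    fun hf hg hfi hgi => ⟨(hindep.comp hf hg).integrable_mul hfi hgi,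
      (hindep.comp hf hg).integral_mul_eq_mul_integral hfi.1 hgi.1⟩
  have hEY : ∀ k, ∫ ω, (W ω • mu + √(W ω) • Z ω) k ∂P = lam * mu k := fun k => by
    obtain ⟨hi, he⟩ := hmul (f := Real.sqrt) (g := fun z => z k) (by fun_prop) (by fun_prop)
      hWsqrt (hZint k)
    simp only [Pi.add_apply, Pi.smul_apply, smul_eq_mul]
    rw [integral_add (hWint.mul_const _) hi, he, hEZ, integral_mul_const, hEW, mul_zero, add_zero]
  obtain ⟨hcross_int, hcross⟩ := hmul (f := fun w => w * √w)
    (g := fun z => mu j * z l + mu l * z j) (by fun_prop) (by fun_prop) hWsqrt'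
    (((hZint l).const_mul _).add ((hZint j).const_mul _))
  obtain ⟨hquad_int, hquad⟩ := hmul (f := fun w => w) (g := fun z => z j * z l) (by fun_prop)
    (by fun_prop) hWint ((hZmem j).integrable_mul (hZmem l))
  have hEcross : ∫ ω, (mu j * Z ω l + mu l * Z ω j) ∂P = 0 := by
    rw [integral_add ((hZint l).const_mul _) ((hZint j).const_mul _), integral_const_mul,
      integral_const_mul, hEZ, hEZ, mul_zero, mul_zero, add_zero]
  have hexpand : (fun ω => (W ω • mu + √(W ω) • Z ω) j * (W ω • mu + √(W ω) • Z ω) l) =ᵐ[P]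
      fun ω => W ω ^ 2 * (mu j * mu l) + W ω * √(W ω) * (mu j * Z ω l + mu l * Z ω j) +
        W ω * (Z ω j * Z ω l) := by
    filter_upwards [hWnonneg] with ω hω
    simp only [Pi.add_apply, Pi.smul_apply, smul_eq_mul]
    linear_combination (Z ω j * Z ω l) * Real.mul_self_sqrt hω
  rw [hEY, hEY, integral_congr_ae hexpand, integral_add (by exact (hWsq.mul_const _).add hcross_int)
    hquad_int, integral_add (hWsq.mul_const _) hcross_int, hcross, hquad, hEcross, hEZZ,
    integral_mul_const, hEW, hEWsq]
  ring
end
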